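/- arXiv:1102.1145 — 5 statements merged into one kernel-verified Lean document; each statement's English description precedes it below -/
import Mathlib

section
/- Let λ be a nonzero real number and k a nonzero complex number. For every real x with sin(λx) ≠ 0, the function ψ(x) = (1 + (iλ/k)·(cos(λx)/sin(λx)))·e^{ikx} satisfies the Schrödinger eigenvalue equation −ψ''(x) + (2λ²/sin²(λx))·ψ(x) = k²·ψ(x). -/
theorem hasDerivAt_ofReal_sin_mul (lam x : ℝ) :
    HasDerivAt (fun y : ℝ => (Real.sin (lam * y) : ℂ)) ((lam : ℂ) * (Real.cos (lam * x) : ℂ)) x := by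
  have h : HasDerivAt (fun y : ℝ => Real.sin (lam * y)) (Real.cos (lam * x) * (lam * 1)) x :=
    ((hasDerivAt_id' x).const_mul lam).sin
  convert h.ofReal_comp using 1
  push_cast
  ring

theorem hasDerivAt_ofReal_cos_mul (lam x : ℝ) :
    HasDerivAt (fun y : ℝ => (Real.cos (lam * y) : ℂ))
      (-((lam : ℂ) * (Real.sin (lam * x) : ℂ))) x := by
  have h : HasDerivAt (fun y : ℝ => Real.cos (lam * y)) (-Real.sin (lam * x) * (lam * 1)) x :=
    ((hasDerivAt_id' x).const_mul lam).cos
  convert h.ofReal_comp using 1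
  push_cast
  ring

theorem hasDerivAt_cexp_mul_ofReal (a : ℂ) (x : ℝ) :
    HasDerivAt (fun y : ℝ => Complex.exp (a * (y : ℂ))) (a * Complex.exp (a * (x : ℂ))) x := by
  have h : HasDerivAt (fun y : ℝ => (y : ℂ)) 1 x := Complex.ofRealCLM.hasDerivAt
  convert (h.const_mul a).cexp using 1
  ring

theorem ofReal_sin_sq_add_cos_sq (t : ℝ) :
    (Real.sin t : ℂ) ^ 2 + (Real.cos t : ℂ) ^ 2 = 1 := by
  exact_mod_cast Real.sin_sq_add_cos_sq t

theorem hasDerivAt_ofReal_cot_mul (lam x : ℝ) (hx : Real.sin (lam * x) ≠ 0) :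
    HasDerivAt (fun y : ℝ => (Real.cos (lam * y) : ℂ) / (Real.sin (lam * y) : ℂ))
      (-(lam : ℂ) / (Real.sin (lam * x) : ℂ) ^ 2) x := by
  have hs : (Real.sin (lam * x) : ℂ) ≠ 0 := Complex.ofReal_ne_zero.mpr hx
  refine ((hasDerivAt_ofReal_cos_mul lam x).fun_div
    (hasDerivAt_ofReal_sin_mul lam x) hs).congr_deriv ?_
  congr 1
  linear_combination (-(lam : ℂ)) * ofReal_sin_sq_add_cos_sq (lam * x)

/-- The Baker–Akhiezer function
`ψ(x) = (1 + (iλ/k)·(cos(λx)/sin(λx)))·e^{ikx}` satisfies the Schrödinger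
eigenvalue equation `−ψ'' + (2λ²/sin²(λx))·ψ = k²·ψ` wherever `sin(λx) ≠ 0`. -/
theorem schroedinger_double_point_curve
    (lam : ℝ) (hlam : lam ≠ 0) (k : ℂ) (hk : k ≠ 0) (ψ : ℝ → ℂ)
    (hψ : ∀ x : ℝ, ψ x =
      (1 + (Complex.I * (lam : ℂ) / k) *
        ((Real.cos (lam * x) : ℂ) / (Real.sin (lam * x) : ℂ))) *
        Complex.exp (Complex.I * k * (x : ℂ))) :
    ∀ x : ℝ, Real.sin (lam * x) ≠ 0 →
      -(deriv (deriv ψ) x) +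
        ((2 * (lam : ℂ) ^ 2) / (Real.sin (lam * x) : ℂ) ^ 2) * ψ x = k ^ 2 * ψ x := by
  obtain rfl : ψ = _ := funext hψ
  intro x hx
  have hs : (Real.sin (lam * x) : ℂ) ≠ 0 := Complex.ofReal_ne_zero.mpr hx
  have hfirst : ∀ y : ℝ, Real.sin (lam * y) ≠ 0 →
      HasDerivAt (fun x : ℝ => (1 + (Complex.I * (lam : ℂ) / k) *
        ((Real.cos (lam * x) : ℂ) / (Real.sin (lam * x) : ℂ))) *
        Complex.exp (Complex.I * k * (x : ℂ)))
      ((Complex.I * (lam : ℂ) / k) * (-(lam : ℂ) / (Real.sin (lam * y) : ℂ) ^ 2) *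
        Complex.exp (Complex.I * k * (y : ℂ)) +
        (1 + (Complex.I * (lam : ℂ) / k) *
          ((Real.cos (lam * y) : ℂ) / (Real.sin (lam * y) : ℂ))) *
          (Complex.I * k * Complex.exp (Complex.I * k * (y : ℂ)))) y := fun y hy =>
    (((hasDerivAt_ofReal_cot_mul lam y hy).const_mul _).const_add 1).fun_mul
      (hasDerivAt_cexp_mul_ofReal _ y)
  have hnear : ∀ᶠ y in nhds x, Real.sin (lam * y) ≠ 0 :=
    (Real.continuous_sin.comp (continuous_const_mul lam)).continuousAt.eventually_ne hx
  have hexp := hasDerivAt_cexp_mul_ofReal (Complex.I * k) x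
  have hcot := ((hasDerivAt_ofReal_cot_mul lam x hx).const_mul
    (Complex.I * (lam : ℂ) / k)).const_add 1
  have hcsc := (((hasDerivAt_const x (-(lam : ℂ))).fun_div
    ((hasDerivAt_ofReal_sin_mul lam x).fun_pow 2) (pow_ne_zero 2 hs)).const_mul
    (Complex.I * (lam : ℂ) / k)).fun_mul hexp
  have hsecond := hcsc.fun_add (hcot.fun_mul (hexp.const_mul (Complex.I * k)))
  have hderiv := Filter.EventuallyEq.deriv_eq (hnear.mono fun y hy => (hfirst y hy).deriv)
  rw [hderiv]
  simp only [mul_assoc] at hsecond ⊢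
  rw [hsecond.deriv]
  generalize Complex.exp _ = e
  generalize (Real.sin (lam * x) : ℂ) = s at *
  generalize (Real.cos (lam * x) : ℂ) = c at *
  field_simp
  ring_nf
  simp only [Complex.I_sq, Complex.I_pow_three]
  ring
end

section
/- Let k be a complex number and l a positive integer. Define functions φ_0, φ_1, …, φ_l on {x ∈ ℝ : x ≠ 0} recursively by φ_0(x) = e^{ikx} and φ_j(x) = −φ_{j−1}'(x) + (j/x)·φ_{j−1}(x) for j = 1,…,l. Then φ_l satisfies the Schrödinger eigenvalue equation −φ_l''(x) + (l(l+1)/x²)·φ_l(x) = k²·φ_l(x) for all x ≠ 0. -/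
/-- The recursively defined functions `φ_0(x) = e^{ikx}`,
`φ_j(x) = −φ_{j−1}'(x) + (j/x)·φ_{j−1}(x)`. -/
noncomputable def phi (k : ℂ) : ℕ → ℝ → ℂ
  | 0 => fun x => Complex.exp (Complex.I * k * (x : ℂ))
  | j + 1 => fun x => -(deriv (phi k j) x) + (((j : ℂ) + 1) / (x : ℂ)) * phi k j x

/-- The functions `φ_l` are twice differentiable away from `0`, and their second derivative is
`(l(l+1)/x² − k²)·φ_l`. -/
theorem hasDerivAt_phi_and_hasDerivAt_deriv_phi (k : ℂ) (l : ℕ) (x : ℝ) (hx : x ≠ 0) :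
    HasDerivAt (phi k l) (deriv (phi k l) x) x ∧
      HasDerivAt (deriv (phi k l))
        (((l : ℂ) * ((l : ℂ) + 1) / (x : ℂ) ^ 2 - k ^ 2) * phi k l x) x := by
  induction l generalizing x with
  | zero =>
    have h (y : ℝ) : HasDerivAt (phi k 0) (Complex.I * k * phi k 0 y) y := by
      have h₁ : HasDerivAt (fun t : ℝ => Complex.I * k * (t : ℂ)) (Complex.I * k) y := by
        simpa using (Complex.ofRealCLM.hasDerivAt (x := y)).const_mul (Complex.I * k)
      simpa only [phi, mul_comm] using h₁.cexp
    have hd : deriv (phi k 0) = fun y => Complex.I * k * phi k 0 y :=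
      funext fun y => (h y).deriv
    refine ⟨(h x).differentiableAt.hasDerivAt, ?_⟩
    rw [hd]
    refine ((h x).const_mul (Complex.I * k)).congr_deriv ?_
    push_cast
    linear_combination (k ^ 2 * phi k 0 x) * Complex.I_sq
  | succ j ih =>
    have hinv (y : ℝ) (hy : y ≠ 0) :
        HasDerivAt (fun t : ℝ => ((j : ℂ) + 1) / (t : ℂ)) (-((j : ℂ) + 1) / (y : ℂ) ^ 2) y := by
      have hy' : (y : ℂ) ≠ 0 := Complex.ofReal_ne_zero.mpr hy
      refine ((hasDerivAt_const y ((j : ℂ) + 1)).div Complex.ofRealCLM.hasDerivAt hy').congr_deriv ?_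
      simp
    have hfirst (y : ℝ) (hy : y ≠ 0) :
        HasDerivAt (phi k (j + 1))
          (k ^ 2 * phi k j y - ((j : ℂ) + 1) / (y : ℂ) * phi k (j + 1) y) y := by
      have hy' : (y : ℂ) ≠ 0 := Complex.ofReal_ne_zero.mpr hy
      refine ((ih y hy).2.neg.add ((hinv y hy).mul (ih y hy).1)).congr_deriv ?_
      simp only [phi]
      field_simp
      ring
    refine ⟨(hfirst x hx).differentiableAt.hasDerivAt, ?_⟩
    have hx' : (x : ℂ) ≠ 0 := Complex.ofReal_ne_zero.mpr hx
    have hsecond :=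
      ((ih x hx).1.const_mul (k ^ 2)).sub ((hinv x hx).mul (hfirst x hx))
    refine (hsecond.congr_of_eventuallyEq ?_).congr_deriv ?_
    · filter_upwards [isOpen_ne.mem_nhds hx] with y hy using (hfirst y hy).deriv
    · simp only [phi]
      push_cast
      field_simp
      ring

/-- `φ_l` satisfies the Schrödinger eigenvalue equation
`−φ_l'' + (l(l+1)/x²)·φ_l = k²·φ_l` for all `x ≠ 0`. -/
theorem schroedinger_rational_soliton_series
    (k : ℂ) (l : ℕ) (hl : 0 < l) :
    ∀ x : ℝ, x ≠ 0 →
      -(deriv (deriv (phi k l)) x) +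
        (((l : ℂ) * ((l : ℂ) + 1)) / (x : ℂ) ^ 2) * phi k l x = k ^ 2 * phi k l x := by
  intro x hx
  rw [(hasDerivAt_phi_and_hasDerivAt_deriv_phi k l x hx).2.deriv]
  ring
end

section
/- Let N ≥ 3 and let β_ij : ℝ^N → ℝ (for i ≠ j) be smooth functions satisfying, for all u ∈ ℝ^N: (i) ∂β_ij/∂u^k = β_ik·β_kj for all pairwise distinct i, j, k, and (ii) Σ_{k=1}^{N} ∂β_ij/∂u^k = 0 for all i ≠ j. Fix vectors a = (a¹,…,a^N), c = (c¹,…,c^N), u₀ ∈ ℝ^N, and define the N×N matrix-valued function B(x,t) by B_{ij}(x,t) = β_ij(u₀ + x·a + t·c) for i ≠ j and B_{ii}(x,t) = 0. Let A = diag(a¹,…,a^N) and C = diag(c¹,…,c^N). Then B satisfies the N-waves equation [A, ∂B/∂t] − [C, ∂B/∂x] = [[A,B],[C,B]] for all (x,t) ∈ ℝ². -/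
/-- The partial derivative `∂f/∂u^k` at `u`, for `f : ℝ^N → ℝ`. -/
noncomputable def pd {N : ℕ} (f : (Fin N → ℝ) → ℝ) (k : Fin N) (u : Fin N → ℝ) : ℝ :=
  fderiv ℝ f u (Pi.single k 1)

theorem fderiv_apply_eq_sum_pd {N : ℕ} (f : (Fin N → ℝ) → ℝ) (u v : Fin N → ℝ) :
    fderiv ℝ f u v = ∑ k, v k * pd f k u := by
  conv_lhs => rw [pi_eq_sum_univ' v]
  simp only [map_sum, map_smul, smul_eq_mul, pd]

theorem deriv_comp_line_eq_sum_pd {N : ℕ} {f : (Fin N → ℝ) → ℝ} (hf : Differentiable ℝ f)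
    {γ : ℝ → Fin N → ℝ} {v : Fin N → ℝ} {s : ℝ} (hγ : HasDerivAt γ v s) :
    deriv (fun r => f (γ r)) s = ∑ k, v k * pd f k (γ s) := by
  rw [← fderiv_apply_eq_sum_pd]
  exact ((hf (γ s)).hasFDerivAt.comp_hasDerivAt s hγ).deriv

/-- The restriction of the rotation coefficients of a flat Egorov
metric to a plane `u = u₀ + x·a + t·c` satisfies the `N`-waves equation
`[A, ∂B/∂t] − [C, ∂B/∂x] = [[A,B],[C,B]]` with `A = diag a`, `C = diag c`. -/
theorem n_waves_equation
    (N : ℕ) (hN : 3 ≤ N)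
    (β : Fin N → Fin N → (Fin N → ℝ) → ℝ)
    (hsmooth : ∀ i j, i ≠ j → ContDiff ℝ (⊤ : ℕ∞) (β i j))
    (h1 : ∀ i j k : Fin N, i ≠ j → j ≠ k → i ≠ k → ∀ u,
      pd (β i j) k u = β i k u * β k j u)
    (h2 : ∀ i j : Fin N, i ≠ j → ∀ u, ∑ k, pd (β i j) k u = 0)
    (a c u₀ : Fin N → ℝ)
    (B : ℝ → ℝ → Matrix (Fin N) (Fin N) ℝ)
    (hB : ∀ x t i j, B x t i j =
      if i = j then 0 else β i j (fun m => u₀ m + x * a m + t * c m))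
    (A C : Matrix (Fin N) (Fin N) ℝ)
    (hA : A = Matrix.diagonal a) (hC : C = Matrix.diagonal c) :
    ∀ x t : ℝ,
      (A * (Matrix.of fun i j => deriv (fun s => B x s i j) t) -
        (Matrix.of fun i j => deriv (fun s => B x s i j) t) * A) -
      (C * (Matrix.of fun i j => deriv (fun s => B s t i j) x) -
        (Matrix.of fun i j => deriv (fun s => B s t i j) x) * C) =
      (A * B x t - B x t * A) * (C * B x t - B x t * C) -
        (C * B x t - B x t * C) * (A * B x t - B x t * A) := by
  intro x t
  subst hA hC
  ext i j
  simp only [Matrix.sub_apply, Matrix.mul_apply (M := _ - _), Matrix.diagonal_mul,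
    Matrix.mul_diagonal, Matrix.of_apply]
  by_cases hij : i = j
  · subst hij
    rw [mul_comm (a i), mul_comm (c i), sub_self, sub_self, sub_self,
      ← Finset.sum_sub_distrib]
    exact (Finset.sum_eq_zero fun k _ => by ring).symm
  · simp only [hB, if_neg hij]
    have hd := (hsmooth i j hij).differentiable (by simp)
    have ht : HasDerivAt (fun s m => u₀ m + x * a m + s * c m) c t :=
      hasDerivAt_pi.2 fun m => by
        simpa using ((hasDerivAt_id t).mul_const (c m)).const_add (u₀ m + x * a m)
    have hx : HasDerivAt (fun s m => u₀ m + s * a m + t * c m) a x :=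
      hasDerivAt_pi.2 fun m => by
        simpa using
          (((hasDerivAt_id x).mul_const (a m)).const_add (u₀ m)).add_const (t * c m)
    rw [deriv_comp_line_eq_sum_pd hd ht, deriv_comp_line_eq_sum_pd hd hx]
    set u : Fin N → ℝ := fun m => u₀ m + x * a m + t * c m
    -- the coefficients of `∂_i` and `∂_j` coincide, so the zero-sum condition removes both
    have hz := congrArg (fun r => (a i * c j - c i * a j) * r) (h2 i j hij u)
    simp only [mul_zero] at hz
    rw [← sub_zero (_ - _ - (_ - _)), ← hz]
    simp only [Finset.mul_sum, Finset.sum_mul, ← Finset.sum_sub_distrib]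
    refine Finset.sum_congr rfl fun k _ => ?_
    by_cases hik : i = k
    · subst hik
      simp only [if_true]
      ring
    by_cases hkj : k = j
    · subst hkj
      simp only [if_true]
      ring
    rw [if_neg hik, if_neg hkj, h1 i j k hij (Ne.symm hkj) hik u]
    ring
end

section
/- Let F : ℝ^N → ℝ be smooth and quasihomogeneous with exponents d_1,…,d_N and degree d_F, i.e., F(λ^{d_1}t¹,…,λ^{d_N}t^N) = λ^{d_F} F(t¹,…,t^N) for all λ > 0 and all t. Let η be a constant symmetric invertible N×N matrix and suppose there is a constant c such that d_α + d_β = c for all pairs α, β with η_{αβ} ≠ 0. Define F̃ : ℝ^{N+2} → ℝ by F̃(t⁰,t¹,…,t^N,t^{N+1}) = (1/2)(Σ_{α,β=1}^{N} η_{αβ} t^α t^β t⁰ + (t⁰)² t^{N+1}) + F(t¹,…,t^N). Then F̃ is quasihomogeneous with exponents d_0 = d_F − c, d_1,…,d_N, d_{N+1} = 2c − d_F and the same degree d_F: F̃(λ^{d_F−c}t⁰, λ^{d_1}t¹,…,λ^{d_N}t^N, λ^{2c−d_F}t^{N+1}) = λ^{d_F} F̃(t⁰,…,t^{N+1}) for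 all λ > 0. -/
/-- The index type of the extended Frobenius structure: `0`, `1,…,N`, `N+1`. -/
abbrev ExtIdx (N : ℕ) : Type := Unit ⊕ Fin N ⊕ Unit

/-- The extended prepotential
`F̃ = ½(Σ_{α,β} η_{αβ} t^α t^β t⁰ + (t⁰)² t^{N+1}) + F(t¹,…,t^N)`. -/
noncomputable def extF {N : ℕ} (η : Matrix (Fin N) (Fin N) ℝ) (F : (Fin N → ℝ) → ℝ) :
    ((ExtIdx N) → ℝ) → ℝ :=
  fun t =>
    (1 / 2) * ((∑ α, ∑ β, η α β * t (Sum.inr (Sum.inl α)) * t (Sum.inr (Sum.inl β)))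
        * t (Sum.inl ()) +
      (t (Sum.inl ())) ^ 2 * t (Sum.inr (Sum.inr ()))) +
    F (fun i => t (Sum.inr (Sum.inl i)))

/-- If `F` is smooth and quasihomogeneous with exponents `d_α` and
degree `d_F`, and `d_α + d_β = c` whenever `η_{αβ} ≠ 0` for a constant symmetric
invertible matrix `η`, then the extended prepotential `F̃` is quasihomogeneous
with exponents `d_0 = d_F − c`, `d_1,…,d_N`, `d_{N+1} = 2c − d_F` and the same
degree `d_F`. -/
theorem extended_prepotential_quasihomogeneous
    (N : ℕ) (F : (Fin N → ℝ) → ℝ) (hF : ContDiff ℝ (⊤ : ℕ∞) F)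
    (d : Fin N → ℝ) (dF : ℝ)
    (hquasi : ∀ l : ℝ, 0 < l → ∀ t : Fin N → ℝ,
      F (fun i => l ^ (d i) * t i) = l ^ dF * F t)
    (η : Matrix (Fin N) (Fin N) ℝ) (hsym : η.IsSymm) (hdet : IsUnit η.det)
    (c : ℝ) (hc : ∀ α β, η α β ≠ 0 → d α + d β = c) :
    ∀ l : ℝ, 0 < l → ∀ t : ExtIdx N → ℝ,
      extF η F (fun i =>
        match i with
        | Sum.inl _ => l ^ (dF - c) * t i
        | Sum.inr (Sum.inl a) => l ^ (d a) * t i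
        | Sum.inr (Sum.inr _) => l ^ (2 * c - dF) * t i) =
      l ^ dF * extF η F t := by
  intro l hl t
  have hsum : ∑ α, ∑ β, η α β * (l ^ d α * t (Sum.inr (Sum.inl α))) *
        (l ^ d β * t (Sum.inr (Sum.inl β))) =
      l ^ c * ∑ α, ∑ β, η α β * t (Sum.inr (Sum.inl α)) * t (Sum.inr (Sum.inl β)) := by
    simp only [Finset.mul_sum]
    refine Finset.sum_congr rfl fun α _ => Finset.sum_congr rfl fun β _ => ?_
    by_cases h : η α β = 0
    · simp [h]
    · rw [← hc α β h, Real.rpow_add hl]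
      ring
  have hlinear : l ^ c * l ^ (dF - c) = l ^ dF := by
    rw [← Real.rpow_add hl]
    congr 1
    ring
  have hquadratic : (l ^ (dF - c)) ^ 2 * l ^ (2 * c - dF) = l ^ dF := by
    rw [sq, ← Real.rpow_add hl, ← Real.rpow_add hl]
    congr 1
    ring
  simp only [extF]
  rw [hsum, hquasi l hl]
  linear_combination
    (1 / 2) * (∑ α, ∑ β, η α β * t (Sum.inr (Sum.inl α)) * t (Sum.inr (Sum.inl β))) *
        t (Sum.inl ()) * hlinear +
      (1 / 2) * t (Sum.inl ()) ^ 2 * t (Sum.inr (Sum.inr ())) * hquadratic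
end

section
/- With c_{111}, c_{112}, c_{122}, c_{222} defined on U = {(x₁,x₂) ∈ ℝ² : x₁ ≠ 0 and 3x₁⁴ + 7x₁²x₂² + 4x₂⁴ ≠ 0} by the explicit formulas: c_{111} = −(9x₁⁸ + 51x₁⁶x₂² + 88x₁⁴x₂⁴ + (2x₁²x₂³ + 4x₂⁵)√((3x₁²+4x₂²)³) + 48x₁²x₂⁶)/(2x₁(3x₁⁴+7x₁²x₂²+4x₂⁴)²); c_{112} = (9x₁⁶x₂ + 15x₁⁴x₂³ − 8x₁²x₂⁵ + (2x₁²x₂² + 4x₂⁴)√((3x₁²+4x₂²)³) − 16x₂⁷)/(2(3x₁⁴+7x₁²x₂²+4x₂⁴)²); c_{122} = −(9x₁⁷ + 15x₁⁵x₂² − 8x₁³x₂⁴ + (2x₁³x₂ + 4x₁x₂³)√((3x₁²+4x₂²)³) − 16x₁x₂⁶)/(2(3x₁⁴+7x₁²x₂²+4x₂⁴)²); c_{222} = (−27x₁⁶x₂ − 16x₂⁷ − 72x₁²x₂⁵ + (4x₁²x₂² + 2x₁⁴)√((3x₁²+4x₂²)³) − 81x₁⁴x₂³)/(2(3x₁⁴+7x₁²x₂²+4x₂⁴)²),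 these functions satisfy on U the associativity relation for N = 2 with η the identity matrix: c_{111}·c_{122} + c_{112}·c_{222} = (c_{112})² + (c_{122})². -/
/-- The correlator `c_{111}` of Example 11 (with `a = 1`, `c = 2/√7`). -/
noncomputable def c111 (x1 x2 : ℝ) : ℝ :=
  -(9 * x1 ^ 8 + 51 * x1 ^ 6 * x2 ^ 2 + 88 * x1 ^ 4 * x2 ^ 4 +
      (2 * x1 ^ 2 * x2 ^ 3 + 4 * x2 ^ 5) * Real.sqrt ((3 * x1 ^ 2 + 4 * x2 ^ 2) ^ 3) +
      48 * x1 ^ 2 * x2 ^ 6) /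
    (2 * x1 * (3 * x1 ^ 4 + 7 * x1 ^ 2 * x2 ^ 2 + 4 * x2 ^ 4) ^ 2)

/-- The correlator `c_{112}` of Example 11. -/
noncomputable def c112 (x1 x2 : ℝ) : ℝ :=
  (9 * x1 ^ 6 * x2 + 15 * x1 ^ 4 * x2 ^ 3 - 8 * x1 ^ 2 * x2 ^ 5 +
      (2 * x1 ^ 2 * x2 ^ 2 + 4 * x2 ^ 4) * Real.sqrt ((3 * x1 ^ 2 + 4 * x2 ^ 2) ^ 3) -
      16 * x2 ^ 7) /
    (2 * (3 * x1 ^ 4 + 7 * x1 ^ 2 * x2 ^ 2 + 4 * x2 ^ 4) ^ 2)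

/-- The correlator `c_{122}` of Example 11. -/
noncomputable def c122 (x1 x2 : ℝ) : ℝ :=
  -(9 * x1 ^ 7 + 15 * x1 ^ 5 * x2 ^ 2 - 8 * x1 ^ 3 * x2 ^ 4 +
      (2 * x1 ^ 3 * x2 + 4 * x1 * x2 ^ 3) * Real.sqrt ((3 * x1 ^ 2 + 4 * x2 ^ 2) ^ 3) -
      16 * x1 * x2 ^ 6) /
    (2 * (3 * x1 ^ 4 + 7 * x1 ^ 2 * x2 ^ 2 + 4 * x2 ^ 4) ^ 2)

/-- The correlator `c_{222}` of Example 11. -/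
noncomputable def c222 (x1 x2 : ℝ) : ℝ :=
  (-27 * x1 ^ 6 * x2 - 16 * x2 ^ 7 - 72 * x1 ^ 2 * x2 ^ 5 +
      (4 * x1 ^ 2 * x2 ^ 2 + 2 * x1 ^ 4) * Real.sqrt ((3 * x1 ^ 2 + 4 * x2 ^ 2) ^ 3) -
      81 * x1 ^ 4 * x2 ^ 3) /
    (2 * (3 * x1 ^ 4 + 7 * x1 ^ 2 * x2 ^ 2 + 4 * x2 ^ 4) ^ 2)

/-- The correlators of Example 11 satisfy the associativity
relation for `N = 2` with the identity metric:
`c_{111}·c_{122} + c_{112}·c_{222} = (c_{112})² + (c_{122})²` on the domain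
`U = {x₁ ≠ 0, 3x₁⁴ + 7x₁²x₂² + 4x₂⁴ ≠ 0}`. -/
theorem correlators_associativity :
    ∀ x1 x2 : ℝ,
      (x1 ≠ 0 ∧ 3 * x1 ^ 4 + 7 * x1 ^ 2 * x2 ^ 2 + 4 * x2 ^ 4 ≠ 0) →
      c111 x1 x2 * c122 x1 x2 + c112 x1 x2 * c222 x1 x2 =
        (c112 x1 x2) ^ 2 + (c122 x1 x2) ^ 2 := by
  rintro x1 x2 ⟨hx, hd⟩
  unfold c111 c112 c122 c222
  field_simp
  ring
end
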